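/- arXiv:2603.08919 — 5 statements merged into one kernel-verified Lean document; each statement's English description precedes it below -/
import Mathlib

section
/- For every T > 0 and every x ∈ ℝ^p one has V_{γ,T}(x) ≤ p·γ·α; that is, sup_{T>0} sup_{x∈ℝ^p} V_{γ,T}(x) ≤ pγα. -/
open MeasureTheory Set Filter Topology
open scoped ENNReal NNReal

noncomputable section

/-- `ℝ^p` with the Euclidean norm. -/
abbrev Ep (p : ℕ) : Type := EuclideanSpace ℝ (Fin p)

/-- The number of jump times `t i` that are `≤ s`. -/
def jumpCount {k : ℕ} (t : Fin k → ℝ) (s : ℝ) : Fin (k + 1) :=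
  ⟨(Finset.univ.filter fun i => t i ≤ s).card,
    Nat.lt_succ_of_le (le_trans (Finset.card_filter_le _ _) (by simp))⟩

/-- `v` is a right-continuous piecewise constant path on `S` with `k` jumps, whose
jump times `t 0 < t 1 < ⋯ < t (k-1)` lie in `J`, whose successive values are
`a 0, a 1, …, a k`, and at each jump exactly one coordinate of `v` changes. -/
def IsPCData {p k : ℕ} (t : Fin k → ℝ) (a : Fin (k + 1) → Ep p)
    (v : ℝ → Ep p) (S J : Set ℝ) : Prop :=
  StrictMono t ∧ (∀ i, t i ∈ J) ∧ (∀ s ∈ S, v s = a (jumpCount t s)) ∧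
    ∀ i : Fin k, ∃! j : Fin p, a (Fin.castSucc i) j ≠ a (Fin.succ i) j

/-- `v` is right-continuous, piecewise constant on `[0,T]` with `k` jumps (in `(0,T]`),
each jump being in exactly one coordinate. -/
def IsPCPath (p : ℕ) (T : ℝ) (v : ℝ → Ep p) (k : ℕ) : Prop :=
  ∃ (t : Fin k → ℝ) (a : Fin (k + 1) → Ep p), IsPCData t a v (Icc 0 T) (Ioc 0 T)

/-- `v` is right-continuous, piecewise constant on `[0,∞)` with `k` jumps,
each jump being in exactly one coordinate. -/
def IsPCPathInf (p : ℕ) (v : ℝ → Ep p) (k : ℕ) : Prop :=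
  ∃ (t : Fin k → ℝ) (a : Fin (k + 1) → Ep p), IsPCData t a v (Ici 0) (Ioi 0)

/-- `u` is Borel measurable with `∫₀ᵀ ‖u‖² < ∞`. -/
def AdmissibleU (p : ℕ) (T : ℝ) (u : ℝ → Ep p) : Prop :=
  Measurable u ∧ IntegrableOn (fun s => ‖u s‖ ^ 2) (Icc 0 T)

/-- `u` is Borel measurable with `∫₀^∞ ‖u‖² < ∞`. -/
def AdmissibleUInf (p : ℕ) (u : ℝ → Ep p) : Prop :=
  Measurable u ∧ IntegrableOn (fun s => ‖u s‖ ^ 2) (Ici 0)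

/-- The reversed controlled trajectory started at `x`: `Y(0) = x`,
`Y' = -b(Y) + u` between the jump times of `v`, and at each jump time of `v`
the path `Y` jumps by the same amount as `v`; equivalently,
`Y(s) = x + ∫₀ˢ (-b(Y(r)) + u(r)) dr + (v(s) - v(0))` on `S`. -/
def RevTraj (p : ℕ) (b : Ep p → Ep p) (u v Y : ℝ → Ep p) (x : Ep p) (S : Set ℝ) : Prop :=
  ∀ s ∈ S, Y s = x + (∫ r in (0:ℝ)..s, (-b (Y r) + u r)) + (v s - v 0)

/-- The value `V_{γ,T}(x)`: infimum over `z` and admissible control pairs `(u,v)` on `[0,T]`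
whose reversed controlled trajectory `Y` started at `x` ends at `Y(T) = z`, of
`Ṽ(z) + (1/2)∫₀ᵀ ‖u‖² + γ·I_L(v)`, where `I_L(v) = α · (number of coordinate jumps of v)`. -/
def VT (p : ℕ) (b : Ep p → Ep p) (Vt : Ep p → ℝ≥0∞) (γ α T : ℝ) (x : Ep p) : ℝ≥0∞ :=
  ⨅ (z : Ep p) (k : ℕ) (u : ℝ → Ep p) (v : ℝ → Ep p) (_ : AdmissibleU p T u)
    (_ : IsPCPath p T v k)
    (_ : ∃ Y : ℝ → Ep p, RevTraj p b u v Y x (Icc 0 T) ∧ Y T = z),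
    Vt z + ENNReal.ofReal ((1 / 2) * (∫ s in Icc (0:ℝ) T, ‖u s‖ ^ 2) + γ * (α * k))

/-- The value `V_γ(x)`: infimum over admissible control pairs `(u,v)` on `[0,∞)`
whose reversed controlled trajectory `Y` started at `x` satisfies `Y(t) → 0`, of
`(1/2)∫₀^∞ ‖u‖² + γ·I_L(v)`. -/
def Vinf (p : ℕ) (b : Ep p → Ep p) (γ α : ℝ) (x : Ep p) : ℝ≥0∞ :=
  ⨅ (k : ℕ) (u : ℝ → Ep p) (v : ℝ → Ep p) (_ : AdmissibleUInf p u)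
    (_ : IsPCPathInf p v k)
    (_ : ∃ Y : ℝ → Ep p, RevTraj p b u v Y x (Ici 0) ∧ Tendsto Y atTop (𝓝 0)),
    ENNReal.ofReal ((1 / 2) * (∫ s in Ici (0:ℝ), ‖u s‖ ^ 2) + γ * (α * k))

/-- `φ` is a solution of the forward ODE `φ' = b(φ)` on `[0,∞)`. -/
def ForwardSol (p : ℕ) (b : Ep p → Ep p) (φ : ℝ → Ep p) : Prop :=
  ∀ t ∈ Ici (0:ℝ), φ t = φ 0 + ∫ r in (0:ℝ)..t, b (φ r)


/-- The vector obtained from `x` by setting to zero its first `n` nonzero coordinates. -/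
def zeroFirst {p : ℕ} (x : Ep p) (n : ℕ) : Ep p :=
  WithLp.toLp 2 fun j =>
    if (Finset.univ.filter fun i => x i ≠ 0 ∧ i < j).card < n then 0 else x j

lemma zeroFirst_apply {p : ℕ} (x : Ep p) (n : ℕ) (j : Fin p) :
    zeroFirst x n j =
      if (Finset.univ.filter fun i => x i ≠ 0 ∧ i < j).card < n then 0 else x j := rfl

lemma zeroFirst_zero {p : ℕ} (x : Ep p) : zeroFirst x 0 = x := by
  ext j
  simp [zeroFirst_apply]

/-- The number of nonzero coordinates of `x`. -/
def supportCard {p : ℕ} (x : Ep p) : ℕ := (Finset.univ.filter fun i => x i ≠ 0).card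

lemma supportCard_le {p : ℕ} (x : Ep p) : supportCard x ≤ p :=
  (Finset.card_filter_le _ _).trans (by simp)

lemma card_filter_lt_supportCard {p : ℕ} (x : Ep p) {j : Fin p} (hj : x j ≠ 0) :
    (Finset.univ.filter fun i => x i ≠ 0 ∧ i < j).card < supportCard x := by
  apply Finset.card_lt_card
  rw [Finset.ssubset_iff_of_subset]
  · exact ⟨j, by simp [hj], by simp⟩
  · intro i
    simp only [Finset.mem_filter]
    tauto

lemma zeroFirst_supportCard {p : ℕ} (x : Ep p) : zeroFirst x (supportCard x) = 0 := by
  ext j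
  rw [zeroFirst_apply]
  split_ifs with h
  · rfl
  · by_contra hj
    exact h (card_filter_lt_supportCard x hj)

lemma norm_zeroFirst_le {p : ℕ} (x : Ep p) (n : ℕ) : ‖zeroFirst x n‖ ≤ ‖x‖ := by
  rw [EuclideanSpace.norm_eq, EuclideanSpace.norm_eq]
  gcongr with j
  rw [zeroFirst_apply]
  split_ifs <;> simp

/-- The rank among nonzero coordinates is injective on nonzero coordinates. -/
lemma card_filter_lt_injOn {p : ℕ} (x : Ep p) :
    Set.InjOn (fun j : Fin p => (Finset.univ.filter fun i => x i ≠ 0 ∧ i < j).card)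
      {j | x j ≠ 0} := by
  have key : ∀ j l : Fin p, x j ≠ 0 → j < l →
      (Finset.univ.filter fun i => x i ≠ 0 ∧ i < j).card <
        (Finset.univ.filter fun i => x i ≠ 0 ∧ i < l).card := by
    intro j l hj hjl
    apply Finset.card_lt_card
    rw [Finset.ssubset_iff_of_subset]
    · exact ⟨j, by simp [hj, hjl], by simp⟩
    · intro i
      simp only [Finset.mem_filter]
      rintro ⟨h1, h2, h3⟩
      exact ⟨h1, h2, h3.trans hjl⟩
  intro j hj l hl h
  simp only at h
  rcases lt_trichotomy j l with hjl | hjl | hjl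
  · exact absurd h (key j l hj hjl).ne
  · exact hjl
  · exact absurd h (key l j hl hjl).ne'

/-- Every rank below `supportCard x` is attained by a nonzero coordinate. -/
lemma exists_card_filter_lt_eq {p : ℕ} (x : Ep p) {n : ℕ} (hn : n < supportCard x) :
    ∃ j, x j ≠ 0 ∧ (Finset.univ.filter fun i => x i ≠ 0 ∧ i < j).card = n := by
  have himg : (Finset.univ.filter fun i => x i ≠ 0).image
      (fun j : Fin p => (Finset.univ.filter fun i => x i ≠ 0 ∧ i < j).card) =
        Finset.range (supportCard x) := by
    apply Finset.eq_of_subset_of_card_le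
    · intro m hm
      obtain ⟨j, hj, rfl⟩ := Finset.mem_image.1 hm
      exact Finset.mem_range.2 (card_filter_lt_supportCard x (by simpa using hj))
    · rw [Finset.card_range, Finset.card_image_of_injOn]
      · rfl
      · intro j hj l hl h
        exact card_filter_lt_injOn x (by simpa using hj) (by simpa using hl) h
  have hm := Finset.mem_range.2 hn
  rw [← himg] at hm
  obtain ⟨j, hj, h⟩ := Finset.mem_image.1 hm
  exact ⟨j, by simpa using hj, h⟩

lemma existsUnique_zeroFirst_ne {p : ℕ} (x : Ep p) {n : ℕ} (hn : n < supportCard x) :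
    ∃! j, zeroFirst x n j ≠ zeroFirst x (n + 1) j := by
  obtain ⟨j, hj, hjn⟩ := exists_card_filter_lt_eq x hn
  refine ⟨j, by simp [zeroFirst_apply, hjn, hj], fun l hl => ?_⟩
  simp only [zeroFirst_apply] at hl
  have hxl : x l ≠ 0 := by
    intro h
    simp [h] at hl
  refine card_filter_lt_injOn x hxl hj ?_
  simp only [hjn]
  split_ifs at hl with h1 h2 h2 <;> first | omega | exact absurd rfl hl

/-- `k` equally spaced jump times in the open interval `(0, ε)`. -/
def jumpTime (ε : ℝ) (k : ℕ) (i : Fin k) : ℝ := ε * ((i + 1) / (k + 1))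

lemma jumpTime_strictMono {ε : ℝ} (hε : 0 < ε) (k : ℕ) : StrictMono (jumpTime ε k) := by
  intro i j hij
  have : ((i : ℕ) : ℝ) < (j : ℕ) := by exact_mod_cast hij
  unfold jumpTime
  gcongr

lemma jumpTime_pos {ε : ℝ} (hε : 0 < ε) {k : ℕ} (i : Fin k) : 0 < jumpTime ε k i := by
  unfold jumpTime
  positivity

lemma jumpTime_le {ε : ℝ} (hε : 0 < ε) {k : ℕ} (i : Fin k) : jumpTime ε k i ≤ ε := by
  have : ((i : ℕ) : ℝ) < k := by exact_mod_cast i.2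
  unfold jumpTime
  refine mul_le_of_le_one_right hε.le ?_
  rw [div_le_one (by positivity)]
  linarith

/-- The path that sets the nonzero coordinates of `x` to zero one at a time during `(0, ε)`. -/
def zeroingPath {p : ℕ} (x : Ep p) (ε s : ℝ) : Ep p :=
  zeroFirst x (jumpCount (jumpTime ε (supportCard x)) s)

lemma measurable_zeroingPath {p : ℕ} (x : Ep p) (ε : ℝ) : Measurable (zeroingPath x ε) := by
  have hcount : Measurable fun s : ℝ =>
      ((jumpCount (jumpTime ε (supportCard x)) s : Fin _) : ℕ) := by
    simp only [jumpCount, Finset.card_filter]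
    exact Finset.measurable_fun_sum _ fun i _ =>
      Measurable.ite measurableSet_Ici measurable_const measurable_const
  exact (measurable_from_top (f := zeroFirst x)).comp hcount

lemma zeroingPath_zero {p : ℕ} (x : Ep p) {ε : ℝ} (hε : 0 < ε) : zeroingPath x ε 0 = x := by
  have : (jumpCount (jumpTime ε (supportCard x)) 0 : ℕ) = 0 := by
    simp only [jumpCount, Finset.card_eq_zero]
    exact Finset.filter_eq_empty_iff.2 fun i _ => not_le.2 (jumpTime_pos hε i)
  rw [zeroingPath, this, zeroFirst_zero]

lemma zeroingPath_of_le {p : ℕ} (x : Ep p) {ε s : ℝ} (hε : 0 < ε) (hs : ε ≤ s) :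
    zeroingPath x ε s = 0 := by
  have : (jumpCount (jumpTime ε (supportCard x)) s : ℕ) = supportCard x := by
    simp only [jumpCount]
    rw [Finset.filter_true_of_mem fun i _ => (jumpTime_le hε i).trans hs]
    simp
  rw [zeroingPath, this, zeroFirst_supportCard]

lemma isPCPath_zeroingPath {p : ℕ} (x : Ep p) {ε T : ℝ} (hε : 0 < ε) (hεT : ε ≤ T) :
    IsPCPath p T (zeroingPath x ε) (supportCard x) :=
  ⟨jumpTime ε (supportCard x), fun m => zeroFirst x m, jumpTime_strictMono hε _,
    fun i => ⟨jumpTime_pos hε i, (jumpTime_le hε i).trans hεT⟩, fun _ _ => rfl,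
    fun i => by simpa using existsUnique_zeroFirst_ne x i.2⟩

lemma norm_sq_comp_zeroingPath_le {p : ℕ} {b : Ep p → Ep p} {L : ℝ≥0}
    (hb : LipschitzWith L b) (hb0 : b 0 = 0) (x : Ep p) (ε s : ℝ) :
    ‖b (zeroingPath x ε s)‖ ^ 2 ≤ (L * ‖x‖) ^ 2 := by
  have h := hb.norm_sub_le (zeroingPath x ε s) 0
  rw [hb0, sub_zero, sub_zero] at h
  have h' : ‖zeroingPath x ε s‖ ≤ ‖x‖ := norm_zeroFirst_le _ _
  gcongr
  exact h.trans (by gcongr)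

lemma admissibleU_comp_zeroingPath {p : ℕ} {b : Ep p → Ep p} {L : ℝ≥0}
    (hb : LipschitzWith L b) (hb0 : b 0 = 0) (x : Ep p) (ε T : ℝ) :
    AdmissibleU p T fun s => b (zeroingPath x ε s) := by
  have hmeas : Measurable fun s => b (zeroingPath x ε s) :=
    hb.continuous.measurable.comp (measurable_zeroingPath x ε)
  refine ⟨hmeas, Measure.integrableOn_of_bounded (M := (L * ‖x‖) ^ 2) (by simp)
    (hmeas.norm.pow_const 2).aestronglyMeasurable (Eventually.of_forall fun s => ?_)⟩
  rw [Real.norm_of_nonneg (by positivity)]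
  exact norm_sq_comp_zeroingPath_le hb hb0 x ε s

lemma integral_norm_sq_comp_zeroingPath_le {p : ℕ} {b : Ep p → Ep p} {L : ℝ≥0}
    (hb : LipschitzWith L b) (hb0 : b 0 = 0) (x : Ep p) {ε T : ℝ} (hε : 0 < ε) (hεT : ε ≤ T) :
    ∫ s in Icc (0:ℝ) T, ‖b (zeroingPath x ε s)‖ ^ 2 ≤ (L * ‖x‖) ^ 2 * ε := by
  have hsub : Icc (0:ℝ) ε ⊆ Icc 0 T := Icc_subset_Icc_right hεT
  have hzero : ∀ s ∈ Icc (0:ℝ) T, s ∉ Icc (0:ℝ) ε → ‖b (zeroingPath x ε s)‖ ^ 2 = 0 := by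
    intro s hs hs'
    have : ε ≤ s := le_of_not_ge fun h => hs' ⟨hs.1, h⟩
    simp [zeroingPath_of_le x hε this, hb0]
  have hrestrict := setIntegral_eq_of_subset_of_forall_sdiff_eq_zero (μ := volume)
    measurableSet_Icc hsub fun s hs => hzero s hs.1 hs.2
  rw [hrestrict]
  calc ∫ s in Icc (0:ℝ) ε, ‖b (zeroingPath x ε s)‖ ^ 2
      ≤ ∫ _ in Icc (0:ℝ) ε, ((L : ℝ) * ‖x‖) ^ 2 :=
        setIntegral_mono (admissibleU_comp_zeroingPath hb hb0 x ε ε).2 (integrableOn_const (by simp))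
          fun s => norm_sq_comp_zeroingPath_le hb hb0 x ε s
    _ = (L * ‖x‖) ^ 2 * ε := by simp [hε.le, mul_comm]

/-- for every `T > 0` and every `x`, `V_{γ,T}(x) ≤ p·γ·α`. -/
theorem uniform_bound_VT
    (p : ℕ) (hp : 1 ≤ p) (b : Ep p → Ep p) (L : ℝ≥0)
    (hb : LipschitzWith L b) (hb0 : b 0 = 0)
    (hattract : ∀ φ : ℝ → Ep p, ForwardSol p b φ → Tendsto φ atTop (𝓝 0))
    (hstable : ∀ ε > (0:ℝ), ∃ δ > (0:ℝ), ∀ φ : ℝ → Ep p, ForwardSol p b φ →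
      ‖φ 0‖ ≤ δ → ∀ t ≥ (0:ℝ), ‖φ t‖ ≤ ε)
    (α γ : ℝ) (hα1 : 1 < α) (hα2 : α < 2) (hγ : 0 < γ)
    (Vt : Ep p → ℝ≥0∞) (hlsc : LowerSemicontinuous Vt)
    (hcpt : ∀ c : ℝ≥0∞, c ≠ ⊤ → IsCompact {y : Ep p | Vt y ≤ c})
    (hconv : ∀ y z : Ep p, y ≠ z → Vt y ≠ ⊤ → Vt z ≠ ⊤ →
      ∀ s t : ℝ, 0 < s → 0 < t → s + t = 1 →
        Vt (s • y + t • z) < ENNReal.ofReal s * Vt y + ENNReal.ofReal t * Vt z)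
    (hV0 : Vt 0 = 0) (hVpos : ∀ y : Ep p, y ≠ 0 → 0 < Vt y)
    : ∀ T > (0:ℝ), ∀ x : Ep p,
      VT p b Vt γ α T x ≤ ENNReal.ofReal (p * γ * α) := by
  intro T hT x
  refine ENNReal.le_of_forall_pos_le_add fun δ hδ _ => ?_
  set C : ℝ := (L * ‖x‖) ^ 2 with hC
  have hC0 : 0 ≤ C := by positivity
  have hδ' : (0:ℝ) < δ := hδ
  set ε : ℝ := min T (δ / (C + 1)) with hεdef
  have hε : 0 < ε := lt_min hT (by positivity)
  have hεT : ε ≤ T := min_le_left _ _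
  have hCε : C * ε ≤ δ := by
    calc C * ε ≤ (C + 1) * (δ / (C + 1)) := by
          gcongr
          · linarith
          · exact min_le_right _ _
      _ = δ := by field_simp
  have hu := admissibleU_comp_zeroingPath hb hb0 x ε T
  have htraj : ∃ Y : ℝ → Ep p, RevTraj p b (fun s => b (zeroingPath x ε s)) (zeroingPath x ε)
      Y x (Icc 0 T) ∧ Y T = 0 :=
    ⟨zeroingPath x ε, fun s _ => by simp [zeroingPath_zero x hε], zeroingPath_of_le x hε hεT⟩
  calc VT p b Vt γ α T x
      ≤ Vt 0 + ENNReal.ofReal ((1 / 2) * (∫ s in Icc (0:ℝ) T, ‖b (zeroingPath x ε s)‖ ^ 2)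
          + γ * (α * supportCard x)) :=
        iInf_le_of_le 0 <| iInf_le_of_le (supportCard x) <| iInf_le_of_le _ <|
          iInf_le_of_le _ <| iInf_le_of_le hu <|
          iInf_le_of_le (isPCPath_zeroingPath x hε hεT) <| iInf_le _ htraj
    _ ≤ ENNReal.ofReal (p * γ * α + δ) := by
        rw [hV0, zero_add]
        apply ENNReal.ofReal_le_ofReal
        have h1 := integral_norm_sq_comp_zeroingPath_le hb hb0 x hε hεT
        have h2 : γ * (α * supportCard x) ≤ γ * (α * p) := by
          have : (supportCard x : ℝ) ≤ p := by exact_mod_cast supportCard_le x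
          gcongr
        linarith
    _ ≤ ENNReal.ofReal (p * γ * α) + δ := by
        rw [← ENNReal.ofReal_coe_nnreal]
        exact ENNReal.ofReal_add_le

end
end

section
/- For every x ∈ ℝ^p one has V_γ(x) ≤ p·γ·α; in particular V_γ is everywhere finite. -/
open MeasureTheory Set Filter Topology
open scoped ENNReal NNReal

noncomputable section

theorem jumpCount_mono {k : ℕ} (t : Fin k → ℝ) : Monotone (jumpCount t) := by
  intro r s hrs
  refine Fin.mk_le_mk.2 (Finset.card_le_card fun i hi => ?_)
  simp only [Finset.mem_filter, Finset.mem_univ, true_and] at hi ⊢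
  exact hi.trans hrs

theorem measurable_jumpCount {k : ℕ} (t : Fin k → ℝ) : Measurable (jumpCount t) := by
  refine measurable_to_countable' fun i => ?_
  have : (jumpCount t ⁻¹' {i}).OrdConnected :=
    ordConnected_singleton.preimage_mono (jumpCount_mono t)
  exact this.measurableSet

theorem jumpCount_eq_last {k : ℕ} (t : Fin k → ℝ) {s : ℝ} (h : ∀ i, t i ≤ s) :
    jumpCount t s = Fin.last k := by
  ext
  simp [jumpCount, h]

theorem jumpCount_eq_zero {k : ℕ} (t : Fin k → ℝ) {s : ℝ} (h : ∀ i, s < t i) :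
    jumpCount t s = 0 := by
  ext
  simp [jumpCount, h]

/-- The nonzero coordinates of a point can be set to zero one at a time. -/
theorem exists_coordinatewise_path_to_zero {p : ℕ} (x : Ep p) :
    ∃ k ≤ p, ∃ a : Fin (k + 1) → Ep p, a 0 = x ∧ a (Fin.last k) = 0 ∧
      ∀ i : Fin k, ∃! j : Fin p, a (Fin.castSucc i) j ≠ a (Fin.succ i) j := by
  classical
  let S : Finset (Fin p) := Finset.univ.filter fun j => x j ≠ 0
  have hS : ∀ j, j ∈ S ↔ x j ≠ 0 := by simp [S]
  let e : S ≃ Fin S.card := S.equivFin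
  refine ⟨S.card, by simpa using S.card_le_univ,
    fun i => WithLp.toLp 2 fun j => if h : j ∈ S then
      (if (e ⟨j, h⟩ : ℕ) < i then 0 else x j) else 0, ?_, ?_, fun i => ⟨e.symm i, ?_, ?_⟩⟩
  · ext j
    by_cases h : x j = 0 <;> simp [hS, h]
  · ext j
    simp
  · have := (hS _).1 (e.symm i).2
    simp [this]
  · intro j hj
    by_cases h : j ∈ S
    · have hij : e ⟨j, h⟩ = i := by
        simp only [h, dite_true, Fin.val_castSucc, Fin.val_succ] at hj
        ext
        by_contra hne
        apply hj
        congr 1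
        exact propext (by omega)
      rw [← hij, e.symm_apply_apply]
    · simp [h] at hj

/-- Moving along finitely many values, ending at `0`, during a time `k * ε`, with a continuous
control that compensates the drift. -/
theorem Vinf_le_of_jumps {p : ℕ} {b : Ep p → Ep p} (hb : Measurable b) (hb0 : b 0 = 0)
    (γ α : ℝ) {k : ℕ} {a : Fin (k + 1) → Ep p} (ha : a (Fin.last k) = 0)
    (hjump : ∀ i : Fin k, ∃! j : Fin p, a (Fin.castSucc i) j ≠ a (Fin.succ i) j)
    {ε : ℝ} (hε : 0 < ε) :
    Vinf p b γ α (a 0) ≤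
      ENNReal.ofReal ((1 / 2) * (k * ε * ∑ i, ‖b (a i)‖ ^ 2) + γ * (α * k)) := by
  let t : Fin k → ℝ := fun i => ((i : ℕ) + 1) * ε
  have ht : ∀ i, 0 < t i := fun i => by positivity
  have htk : ∀ i, t i ≤ k * ε := fun i => by
    have : ((i : ℕ) : ℝ) + 1 ≤ k := by exact_mod_cast i.2
    exact mul_le_mul_of_nonneg_right this hε.le
  let v : ℝ → Ep p := fun s => a (jumpCount t s)
  have hv : Measurable v := (Measurable.of_discrete (f := a)).comp (measurable_jumpCount t)
  have hv0 : v 0 = a 0 := congrArg a (jumpCount_eq_zero t ht)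
  have hvk : ∀ s, k * ε ≤ s → v s = 0 := fun s hs => by
    simp only [v, jumpCount_eq_last t fun i => (htk i).trans hs, ha]
  set C : ℝ := ∑ i, ‖b (a i)‖ ^ 2
  have hC : ∀ s, ‖b (v s)‖ ^ 2 ≤ C := fun s =>
    Finset.single_le_sum (f := fun i => ‖b (a i)‖ ^ 2) (fun i _ => by positivity)
      (Finset.mem_univ (jumpCount t s))
  have hk : 0 ≤ k * ε := by positivity
  have hle : ∀ s ∈ Ici (0 : ℝ),
      ‖b (v s)‖ ^ 2 ≤ (Icc (0 : ℝ) (k * ε)).indicator (fun _ => C) s := by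
    intro s hs
    by_cases h : s ≤ k * ε
    · rw [indicator_of_mem (show s ∈ Icc (0 : ℝ) (k * ε) from ⟨hs, h⟩)]
      exact hC s
    · rw [indicator_of_notMem fun h' => h h'.2, hvk s (not_le.1 h).le, hb0]
      simp
  have hint : Integrable ((Icc (0 : ℝ) (k * ε)).indicator fun _ => C) :=
    (integrable_indicator_iff measurableSet_Icc).2 continuousOn_const.integrableOn_Icc
  have hu : Measurable fun s => b (v s) := hb.comp hv
  have hui : IntegrableOn (fun s => ‖b (v s)‖ ^ 2) (Ici 0) := by
    refine Integrable.mono' hint.integrableOn (hu.norm.pow_const 2).aestronglyMeasurable ?_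
    filter_upwards [ae_restrict_mem measurableSet_Ici] with s hs
    rw [Real.norm_of_nonneg (by positivity)]
    exact hle s hs
  have hcost : ∫ s in Ici (0 : ℝ), ‖b (v s)‖ ^ 2 ≤ k * ε * C := by
    refine (setIntegral_mono_on hui hint.integrableOn measurableSet_Ici hle).trans_eq ?_
    rw [setIntegral_indicator measurableSet_Icc,
      inter_eq_right.2 Icc_subset_Ici_self]
    simp [hk]
  refine iInf_le_of_le k <| iInf_le_of_le (fun s => b (v s)) <| iInf_le_of_le v <|
    iInf_le_of_le ⟨hu, hui⟩ <| iInf_le_of_le ⟨t, a, ?_, ht, fun s _ => rfl, hjump⟩ <|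
    iInf_le_of_le ⟨v, fun s _ => by simp [hv0], ?_⟩ <| ENNReal.ofReal_le_ofReal (by gcongr)
  · intro i j hij
    have : ((i : ℕ) : ℝ) < (j : ℕ) := by exact_mod_cast hij
    exact mul_lt_mul_of_pos_right (by linarith) hε
  · refine tendsto_const_nhds.congr' ?_
    filter_upwards [eventually_ge_atTop (k * ε)] with s hs using (hvk s hs).symm

/-- for every `x`, `V_γ(x) ≤ p·γ·α`; in particular `V_γ` is everywhere finite. -/
theorem Vinf_le_and_finite
    (p : ℕ) (hp : 1 ≤ p) (b : Ep p → Ep p) (L : ℝ≥0)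
    (hb : LipschitzWith L b) (hb0 : b 0 = 0)
    (hattract : ∀ φ : ℝ → Ep p, ForwardSol p b φ → Tendsto φ atTop (𝓝 0))
    (hstable : ∀ ε > (0:ℝ), ∃ δ > (0:ℝ), ∀ φ : ℝ → Ep p, ForwardSol p b φ →
      ‖φ 0‖ ≤ δ → ∀ t ≥ (0:ℝ), ‖φ t‖ ≤ ε)
    (α γ : ℝ) (hα1 : 1 < α) (hα2 : α < 2) (hγ : 0 < γ)
    : ∀ x : Ep p,
      Vinf p b γ α x ≤ ENNReal.ofReal (p * γ * α) ∧ Vinf p b γ α x ≠ ⊤ := by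
  intro x
  have key : Vinf p b γ α x ≤ ENNReal.ofReal (p * γ * α) := by
    obtain ⟨k, hkp, a, ha0, ha, hjump⟩ := exists_coordinatewise_path_to_zero x
    subst ha0
    have hlim : Tendsto (fun ε : ℝ => ENNReal.ofReal
        ((1 / 2) * (k * ε * ∑ i, ‖b (a i)‖ ^ 2) + γ * (α * k))) (𝓝[>] 0)
        (𝓝 (ENNReal.ofReal (γ * (α * k)))) := by
      refine (ENNReal.continuous_ofReal.tendsto _).comp ?_
      refine (Continuous.tendsto' ?_ _ _ ?_).mono_left nhdsWithin_le_nhds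
      · fun_prop
      · simp
    refine (ge_of_tendsto hlim ?_).trans (ENNReal.ofReal_le_ofReal ?_)
    · filter_upwards [self_mem_nhdsWithin] with ε hε
      exact Vinf_le_of_jumps hb.continuous.measurable hb0 γ α ha hjump hε
    · have hkp' : (k : ℝ) ≤ p := by exact_mod_cast hkp
      have : γ * α * k ≤ γ * α * p := mul_le_mul_of_nonneg_left hkp' (by positivity)
      linarith
  exact ⟨key, ne_top_of_le_ne_top ENNReal.ofReal_ne_top key⟩

end
end

section
/- For every nonempty set U ⊆ ℝ^p, limsup_{T→∞} inf_{x∈U} V_{γ,T}(x) ≤ inf_{x∈U} V_γ(x). -/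
open MeasureTheory Set Filter Topology
open scoped ENNReal NNReal

noncomputable section

theorem IsPCData.exists_eventually_const {p k : ℕ} {t : Fin k → ℝ} {a : Fin (k + 1) → Ep p}
    {v : ℝ → Ep p} (h : IsPCData t a v (Ici 0) (Ioi 0)) :
    ∃ M : ℝ, 0 ≤ M ∧ (∀ i, t i ≤ M) ∧ ∀ s, M ≤ s → v s = v M := by
  obtain ⟨M, hM⟩ := (Set.finite_range t).bddAbove
  have ht : ∀ i, t i ≤ max M 0 := fun i => (hM ⟨i, rfl⟩).trans (le_max_left _ _)
  refine ⟨max M 0, le_max_right _ _, ht, fun s hs => ?_⟩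
  have h0 : 0 ≤ max M 0 := le_max_right _ _
  rw [h.2.2.1 s (h0.trans hs), h.2.2.1 _ h0]
  congr 1
  simp only [jumpCount, Fin.mk.injEq]
  congr 1
  ext i
  simp only [Finset.mem_filter, ht i, (ht i).trans hs]

theorem IsPCData.isPCPath {p k : ℕ} {t : Fin k → ℝ} {a : Fin (k + 1) → Ep p} {v : ℝ → Ep p}
    (h : IsPCData t a v (Ici 0) (Ioi 0)) {T : ℝ} (hT : ∀ i, t i ≤ T) : IsPCPath p T v k :=
  ⟨t, a, h.1, fun i => ⟨h.2.1 i, hT i⟩, fun s hs => h.2.2.1 s hs.1, h.2.2.2⟩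

theorem VT_le_of_traj {p k : ℕ} {b : Ep p → Ep p} {Vt : Ep p → ℝ≥0∞} (hV0 : Vt 0 = 0)
    {γ α T c : ℝ} {x : Ep p} {u v Y : ℝ → Ep p} (hu : AdmissibleU p T u) (hv : IsPCPath p T v k)
    (hY : RevTraj p b u v Y x (Icc 0 T)) (hYT : Y T = 0)
    (hc : ∫ s in Icc (0:ℝ) T, ‖u s‖ ^ 2 ≤ c) :
    VT p b Vt γ α T x ≤ ENNReal.ofReal ((1 / 2) * c + γ * (α * k)) := by
  unfold VT
  refine iInf_le_of_le 0 <| iInf_le_of_le k <| iInf_le_of_le u <| iInf_le_of_le v <|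
    iInf_le_of_le hu <| iInf_le_of_le hv <| iInf_le_of_le ⟨Y, hY, hYT⟩ ?_
  rw [hV0, zero_add]
  exact ENNReal.ofReal_le_ofReal (by linarith)

/-- The control following `u` up to time `R` and then driving `y` to `0` along a segment
during `[R, R + 1]`. -/
def steeredControl {p : ℕ} (b : Ep p → Ep p) (u : ℝ → Ep p) (R : ℝ) (y : Ep p) (s : ℝ) : Ep p :=
  if s ≤ R then u s else -y + b ((R + 1 - s) • y)

/-- The path following `Y` up to time `R` and then the segment from `Y R` to `0`
during `[R, R + 1]`. -/
def steeredPath {p : ℕ} (Y : ℝ → Ep p) (R s : ℝ) : Ep p :=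
  if s ≤ R then Y s else (R + 1 - s) • Y R

theorem measurable_steeredControl {p : ℕ} {b : Ep p → Ep p} (hb : Continuous b) {u : ℝ → Ep p}
    (hu : Measurable u) (R : ℝ) (y : Ep p) : Measurable (steeredControl b u R y) :=
  Measurable.ite measurableSet_Iic hu
    (Continuous.measurable (by fun_prop))

theorem norm_steeredControl_sq_le {p : ℕ} {b : Ep p → Ep p} {L : ℝ≥0} (hb : LipschitzWith L b)
    (hb0 : b 0 = 0) (u : ℝ → Ep p) (R : ℝ) (y : Ep p) {s : ℝ} (hs : s ≤ R + 1) :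
    ‖steeredControl b u R y s‖ ^ 2 ≤
      ‖u s‖ ^ 2 + (Ioc R (R + 1)).indicator (fun _ => ((1 + L) * ‖y‖) ^ 2) s := by
  unfold steeredControl
  split_ifs with h
  · rw [Set.indicator_of_notMem (fun h' => h'.1.not_ge h), add_zero]
  · push Not at h
    rw [Set.indicator_of_mem (show s ∈ Ioc R (R + 1) from ⟨h, hs⟩)]
    have h1 : ‖b ((R + 1 - s) • y)‖ ≤ L * ‖y‖ := by
      have h2 := hb.norm_sub_le ((R + 1 - s) • y) 0
      rw [hb0, sub_zero, sub_zero, norm_smul, Real.norm_of_nonneg (by linarith)] at h2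
      refine h2.trans (mul_le_mul_of_nonneg_left ?_ L.2)
      exact mul_le_of_le_one_left (norm_nonneg _) (by linarith)
    have h3 : ‖-y + b ((R + 1 - s) • y)‖ ≤ (1 + L) * ‖y‖ := by
      refine (norm_add_le _ _).trans ?_
      rw [norm_neg]
      linarith
    have h4 := pow_le_pow_left₀ (norm_nonneg _) h3 2
    have h5 := sq_nonneg ‖u s‖
    linarith

theorem steeredControl_cost {p : ℕ} {b : Ep p → Ep p} {L : ℝ≥0} (hb : LipschitzWith L b)
    (hb0 : b 0 = 0) {u : ℝ → Ep p} (hu : AdmissibleUInf p u) {R : ℝ} (hR : 0 ≤ R) (y : Ep p) :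
    AdmissibleU p (R + 1) (steeredControl b u R y) ∧
      ∫ s in Icc (0:ℝ) (R + 1), ‖steeredControl b u R y s‖ ^ 2 ≤
        (∫ s in Ici (0:ℝ), ‖u s‖ ^ 2) + ((1 + L) * ‖y‖) ^ 2 := by
  set C := ((1 + L) * ‖y‖) ^ 2
  have hm := measurable_steeredControl hb.continuous hu.1 R y
  have hui : IntegrableOn (fun s => ‖u s‖ ^ 2) (Icc 0 (R + 1)) := hu.2.mono_set Icc_subset_Ici_self
  have hind : IntegrableOn ((Ioc R (R + 1)).indicator fun _ => C) (Icc 0 (R + 1)) :=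
    (integrable_const C).indicator measurableSet_Ioc
  have hle : ∀ s ∈ Icc (0:ℝ) (R + 1), ‖steeredControl b u R y s‖ ^ 2 ≤
      ‖u s‖ ^ 2 + (Ioc R (R + 1)).indicator (fun _ => C) s :=
    fun s hs => norm_steeredControl_sq_le hb hb0 u R y hs.2
  have hint : IntegrableOn (fun s => ‖steeredControl b u R y s‖ ^ 2) (Icc 0 (R + 1)) := by
    refine Integrable.mono' (hui.add hind) (hm.norm.pow_const 2).aestronglyMeasurable ?_
    filter_upwards [ae_restrict_mem measurableSet_Icc] with s hs
    rw [Real.norm_of_nonneg (sq_nonneg _)]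
    exact hle s hs
  refine ⟨⟨hm, hint⟩, ?_⟩
  calc ∫ s in Icc (0:ℝ) (R + 1), ‖steeredControl b u R y s‖ ^ 2
      ≤ ∫ s in Icc (0:ℝ) (R + 1), (‖u s‖ ^ 2 + (Ioc R (R + 1)).indicator (fun _ => C) s) :=
        setIntegral_mono_on hint (hui.add hind) measurableSet_Icc hle
    _ = (∫ s in Icc (0:ℝ) (R + 1), ‖u s‖ ^ 2) + C := by
        rw [integral_add hui hind, setIntegral_indicator measurableSet_Ioc,
          inter_eq_self_of_subset_right (Ioc_subset_Icc_self.trans (Icc_subset_Icc_left hR))]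
        simp
    _ ≤ _ := by
        have := setIntegral_mono_set hu.2 (Eventually.of_forall fun s => sq_nonneg ‖u s‖)
          (Icc_subset_Ici_self : Icc (0:ℝ) (R + 1) ⊆ Ici 0).eventuallyLE
        linarith

theorem revTraj_steeredPath {p : ℕ} {b : Ep p → Ep p} {u v Y : ℝ → Ep p} {x : Ep p} {R : ℝ}
    (hR : 0 ≤ R) (hY : RevTraj p b u v Y x (Ici 0)) (hv : ∀ s, R ≤ s → v s = v R)
    (hint : IntervalIntegrable (fun r => -b (Y r) + u r) volume 0 R) :
    RevTraj p b (steeredControl b u R (Y R)) v (steeredPath Y R) x (Icc 0 (R + 1)) := by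
  have hpre : ∀ r, r ≤ R → -b (steeredPath Y R r) + steeredControl b u R (Y R) r
      = -b (Y r) + u r := fun r hr => by simp [steeredPath, steeredControl, hr]
  have hpost : ∀ r, R < r → -b (steeredPath Y R r) + steeredControl b u R (Y R) r = -Y R :=
    fun r hr => by simp [steeredPath, steeredControl, hr.not_ge]
  have hpreI : ∀ s, 0 ≤ s → s ≤ R →
      ∫ r in (0:ℝ)..s, (-b (steeredPath Y R r) + steeredControl b u R (Y R) r)
        = ∫ r in (0:ℝ)..s, (-b (Y r) + u r) := fun s h0 hs => by
    refine intervalIntegral.integral_congr fun r hr => hpre r ?_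
    rw [uIcc_of_le h0] at hr
    exact hr.2.trans hs
  intro s hs
  rcases le_or_gt s R with h | h
  · rw [hpreI s hs.1 h, ← hY s hs.1]
    simp [steeredPath, h]
  · have e1 : EqOn (fun r => -b (steeredPath Y R r) + steeredControl b u R (Y R) r)
        (fun _ => -Y R) (uIoc R s) := fun r hr => by
      rw [uIoc_of_le h.le] at hr
      exact hpost r hr.1
    have i1 : IntervalIntegrable
        (fun r => -b (steeredPath Y R r) + steeredControl b u R (Y R) r) volume 0 R :=
      hint.congr fun r hr => by
        rw [uIoc_of_le hR] at hr
        exact (hpre r hr.2).symm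
    have i2 : IntervalIntegrable
        (fun r => -b (steeredPath Y R r) + steeredControl b u R (Y R) r) volume R s :=
      (intervalIntegrable_const (c := -Y R)).congr e1.symm
    rw [← intervalIntegral.integral_add_adjacent_intervals i1 i2, hpreI R hR le_rfl,
      intervalIntegral.integral_congr_ae (Eventually.of_forall e1),
      intervalIntegral.integral_const, hv s h.le]
    have hYR := hY R hR
    have hZ : steeredPath Y R s = (R + 1 - s) • Y R := by simp [steeredPath, h.not_ge]
    rw [hZ]
    calc (R + 1 - s) • Y R = Y R + (s - R) • (-Y R) := by module
      _ = x + (∫ r in (0:ℝ)..R, (-b (Y r) + u r)) + (v R - v 0) + (s - R) • (-Y R) := by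
        rw [← hYR]
      _ = _ := by abel

/-- If the velocity fails to be integrable up to time `R`, the convention that its integral is `0`
forces a trajectory converging to `0` to vanish once the jumps are over. -/
theorem RevTraj.eq_zero_of_not_intervalIntegrable {p : ℕ} {b : Ep p → Ep p} {u v Y : ℝ → Ep p}
    {x : Ep p} {R : ℝ} (hR : 0 ≤ R) (hY : RevTraj p b u v Y x (Ici 0))
    (hv : ∀ s, R ≤ s → v s = v R) (hlim : Tendsto Y atTop (𝓝 0))
    (hint : ¬ IntervalIntegrable (fun r => -b (Y r) + u r) volume 0 R) {T : ℝ} (hT : R ≤ T) :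
    Y T = 0 := by
  have key : ∀ s, R ≤ s → Y s = x + (v R - v 0) := fun s hs => by
    rw [hY s (hR.trans hs), intervalIntegral.integral_undef, hv s hs, add_zero]
    refine fun h => hint (h.mono_set ?_)
    rw [uIcc_of_le hR, uIcc_of_le (hR.trans hs)]
    exact Icc_subset_Icc_right hs
  have hc : Tendsto Y atTop (𝓝 (x + (v R - v 0))) :=
    tendsto_const_nhds.congr' ((eventually_ge_atTop R).mono fun s hs => (key s hs).symm)
  rw [key T hT]
  exact tendsto_nhds_unique hc hlim

theorem eventually_VT_le {p k : ℕ} {b : Ep p → Ep p} {L : ℝ≥0} (hb : LipschitzWith L b)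
    (hb0 : b 0 = 0) {Vt : Ep p → ℝ≥0∞} (hV0 : Vt 0 = 0) {γ α : ℝ} {x : Ep p}
    {u v Y : ℝ → Ep p} (hu : AdmissibleUInf p u) (hv : IsPCPathInf p v k)
    (hY : RevTraj p b u v Y x (Ici 0)) (hlim : Tendsto Y atTop (𝓝 0)) :
    ∀ᶠ T in atTop, VT p b Vt γ α T x ≤ ENNReal.ofReal
      ((1 / 2) * ((∫ s in Ici (0:ℝ), ‖u s‖ ^ 2) + ((1 + L) * ‖Y (T - 1)‖) ^ 2) + γ * (α * k)) := by
  obtain ⟨t, a, hta⟩ := hv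
  obtain ⟨M, hM0, htM, hvM⟩ := hta.exists_eventually_const
  filter_upwards [eventually_ge_atTop (M + 1)] with T hT
  obtain ⟨R, rfl⟩ : ∃ R, T = R + 1 := ⟨T - 1, by ring⟩
  have hMR : M ≤ R := by linarith
  have hR : 0 ≤ R := hM0.trans hMR
  have hvR : ∀ s, R ≤ s → v s = v R := fun s hs => by
    rw [hvM s (hMR.trans hs), hvM R hMR]
  have hpath : IsPCPath p (R + 1) v k := hta.isPCPath fun i => (htM i).trans (by linarith)
  rw [add_sub_cancel_right]
  by_cases hint : IntervalIntegrable (fun r => -b (Y r) + u r) volume 0 R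
  · obtain ⟨hadm, hcost⟩ := steeredControl_cost hb hb0 hu hR (Y R)
    exact VT_le_of_traj hV0 hadm hpath (revTraj_steeredPath hR hY hvR hint)
      (by simp [steeredPath]) hcost
  · refine VT_le_of_traj hV0 ⟨hu.1, hu.2.mono_set Icc_subset_Ici_self⟩ hpath
      (fun s hs => hY s hs.1)
      (hY.eq_zero_of_not_intervalIntegrable hR hvR hlim hint (by linarith)) ?_
    have := setIntegral_mono_set hu.2 (Eventually.of_forall fun s => sq_nonneg ‖u s‖)
      (Icc_subset_Ici_self : Icc (0:ℝ) (R + 1) ⊆ Ici 0).eventuallyLE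
    have := sq_nonneg ((1 + L) * ‖Y R‖)
    linarith

/-- for every nonempty `U`,
`limsup_{T→∞} inf_{x∈U} V_{γ,T}(x) ≤ inf_{x∈U} V_γ(x)`. -/
theorem limsup_inf_VT_le
    (p : ℕ) (hp : 1 ≤ p) (b : Ep p → Ep p) (L : ℝ≥0)
    (hb : LipschitzWith L b) (hb0 : b 0 = 0)
    (hattract : ∀ φ : ℝ → Ep p, ForwardSol p b φ → Tendsto φ atTop (𝓝 0))
    (hstable : ∀ ε > (0:ℝ), ∃ δ > (0:ℝ), ∀ φ : ℝ → Ep p, ForwardSol p b φ →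
      ‖φ 0‖ ≤ δ → ∀ t ≥ (0:ℝ), ‖φ t‖ ≤ ε)
    (α γ : ℝ) (hα1 : 1 < α) (hα2 : α < 2) (hγ : 0 < γ)
    (Vt : Ep p → ℝ≥0∞) (hlsc : LowerSemicontinuous Vt)
    (hcpt : ∀ c : ℝ≥0∞, c ≠ ⊤ → IsCompact {y : Ep p | Vt y ≤ c})
    (hconv : ∀ y z : Ep p, y ≠ z → Vt y ≠ ⊤ → Vt z ≠ ⊤ →
      ∀ s t : ℝ, 0 < s → 0 < t → s + t = 1 →
        Vt (s • y + t • z) < ENNReal.ofReal s * Vt y + ENNReal.ofReal t * Vt z)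
    (hV0 : Vt 0 = 0) (hVpos : ∀ y : Ep p, y ≠ 0 → 0 < Vt y)
    (U : Set (Ep p)) (hUne : U.Nonempty) :
    atTop.limsup (fun T : ℝ => ⨅ x ∈ U, VT p b Vt γ α T x) ≤
      ⨅ x ∈ U, Vinf p b γ α x := by
  refine le_iInf₂ fun x hx => ?_
  unfold Vinf
  refine le_iInf fun k => le_iInf fun u => le_iInf fun v => le_iInf fun hu => le_iInf fun hv =>
    le_iInf ?_
  rintro ⟨Y, hY, hlim⟩
  have hsteer : Tendsto (fun T : ℝ => ENNReal.ofReal ((1 / 2) *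
      ((∫ s in Ici (0:ℝ), ‖u s‖ ^ 2) + ((1 + L) * ‖Y (T - 1)‖) ^ 2) + γ * (α * k))) atTop
      (𝓝 (ENNReal.ofReal ((1 / 2) * (∫ s in Ici (0:ℝ), ‖u s‖ ^ 2) + γ * (α * k)))) := by
    refine ENNReal.tendsto_ofReal ?_
    have hshift : Tendsto (fun T : ℝ => T - 1) atTop atTop :=
      tendsto_atTop_add_const_right _ (-1) tendsto_id
    have h := ((((hlim.comp hshift).norm.const_mul (1 + (L : ℝ))).pow 2).const_add
      (∫ s in Ici (0:ℝ), ‖u s‖ ^ 2)).const_mul (1 / 2)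
    simpa using h.add_const (γ * (α * k))
  rw [← hsteer.limsup_eq]
  refine limsup_le_limsup ?_
  filter_upwards [eventually_VT_le (γ := γ) (α := α) hb hb0 hV0 hu hv hY hlim] with T hT
  exact (iInf₂_le x hx).trans hT

end
end

section
/- Let t₀ ≥ 0 and suppose Y : [t₀, ∞) → ℝ^p is locally absolutely continuous with Y'(t) = −b(Y(t)) + u(t) for almost every t ≥ t₀, where u : [t₀,∞) → ℝ^p is Borel measurable and locally square-integrable. If there exist 0 < r₁ < r₂ such that r₁ < ‖Y(t)‖ < r₂ for all t ≥ t₀, then ∫_{t₀}^∞ ‖u(s)‖² ds = +∞. -/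
open MeasureTheory Set Filter Topology
open scoped ENNReal NNReal

noncomputable section

/-- Grönwall's inequality in integral form, with the bound expressed by `gronwallBound`. -/
theorem le_add_mul_gronwallBound_of_le_integral {w : ℝ → ℝ} (hw : Continuous w)
    (hw0 : ∀ t, 0 ≤ w t) {L η T : ℝ} (hL : 0 ≤ L) (hT : 0 ≤ T)
    (h : ∀ t ∈ Icc 0 T, w t ≤ η + L * ∫ r in (0:ℝ)..t, w r) :
    w T ≤ η + L * gronwallBound 0 L η T := by
  have hderiv : ∀ t, HasDerivAt (fun s => ∫ r in (0:ℝ)..s, w r) (w t) t := fun t =>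
    intervalIntegral.integral_hasDerivAt_right (hw.intervalIntegrable _ _)
      (hw.stronglyMeasurableAtFilter _ _) hw.continuousAt
  have hbound := norm_le_gronwallBound_of_norm_deriv_right_le (δ := 0) (K := L) (ε := η)
    (a := 0) (b := T) (fun t _ => (hderiv t).continuousAt.continuousWithinAt)
    (fun t _ => (hderiv t).hasDerivWithinAt) (by simp)
    (fun t ht => by
      have hnn : 0 ≤ ∫ r in (0:ℝ)..t, w r :=
        intervalIntegral.integral_nonneg ht.1 fun r _ => hw0 r
      rw [Real.norm_of_nonneg (hw0 t), Real.norm_of_nonneg hnn]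
      linarith [h t ⟨ht.1, ht.2.le⟩])
    T ⟨hT, le_rfl⟩
  rw [sub_zero] at hbound
  have hle := h T ⟨hT, le_rfl⟩
  have := mul_le_mul_of_nonneg_left ((le_abs_self _).trans hbound) hL
  linarith

theorem integrableOn_of_integrableOn_norm_sq {E : Type*} [NormedAddCommGroup E]
    {u : ℝ → E} {S : Set ℝ}
    (hu : AEStronglyMeasurable u (volume.restrict S)) (hS : volume S ≠ ⊤)
    (h : IntegrableOn (fun s => ‖u s‖ ^ 2) S) : IntegrableOn u S := by
  have hone : IntegrableOn (fun _ : ℝ => (1:ℝ)) S := integrableOn_const hS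
  refine Integrable.mono' (Integrable.add hone h) hu (ae_of_all _ fun s => ?_)
  simp only [Pi.add_apply]
  nlinarith [sq_nonneg (‖u s‖ - 1), norm_nonneg (u s)]

/-- The integral of the norm of a square-integrable function over a window of fixed length
vanishes as the window moves to infinity. -/
theorem tendsto_integral_norm_sliding_window {E : Type*} [NormedAddCommGroup E]
    {u : ℝ → E} (hu : StronglyMeasurable u) {t₀ : ℝ}
    (h : IntegrableOn (fun s => ‖u s‖ ^ 2) (Ici t₀)) {T : ℝ} (hT : 0 ≤ T) :
    Tendsto (fun s => ∫ r in (s - T)..s, ‖u r‖) atTop (𝓝 0) := by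
  have hsub : Tendsto (fun s : ℝ => s - T) atTop atTop :=
    tendsto_atTop_add_const_right _ _ tendsto_id
  have hJ := intervalIntegral_tendsto_integral_Ioi t₀ (h.mono_set Ioi_subset_Ici_self) tendsto_id
  have hJT := intervalIntegral_tendsto_integral_Ioi t₀ (h.mono_set Ioi_subset_Ici_self) hsub
  have hlim : Tendsto (fun s => √(T * ((∫ r in t₀..s, ‖u r‖ ^ 2)
      - ∫ r in t₀..(s - T), ‖u r‖ ^ 2))) atTop (𝓝 0) := by
    have := (Real.continuous_sqrt.tendsto _).comp ((hJ.sub hJT).const_mul T)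
    simpa [Function.comp_def] using this
  refine squeeze_zero' (Eventually.of_forall fun s =>
    intervalIntegral.integral_nonneg (by linarith) fun r _ => norm_nonneg _) ?_ hlim
  filter_upwards [eventually_ge_atTop (t₀ + T)] with s hs
  have hst : t₀ ≤ s - T := by linarith
  have hint : ∀ a c, t₀ ≤ a → a ≤ c → IntervalIntegrable (fun r => ‖u r‖ ^ 2) volume a c := by
    intro a c ha hac
    rw [intervalIntegrable_iff_integrableOn_Icc_of_le hac]
    exact h.mono_set fun x hx => ha.trans hx.1
  have hint1 : IntervalIntegrable (fun r => ‖u r‖) volume (s - T) s := by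
    rw [intervalIntegrable_iff_integrableOn_Icc_of_le (by linarith)]
    exact (integrableOn_of_integrableOn_norm_sq hu.aestronglyMeasurable (by simp)
      (h.mono_set fun x hx => hst.trans hx.1)).norm
  have hint2 := hint (s - T) s hst (by linarith)
  rw [intervalIntegral.integral_interval_sub_left (hint _ _ le_rfl (by linarith))
    (hint _ _ le_rfl hst)]
  apply Real.le_sqrt_of_sq_le
  have hquad : ∀ m : ℝ, 0 ≤ T * (m * m) + (-2 * ∫ r in (s - T)..s, ‖u r‖) * m
      + ∫ r in (s - T)..s, ‖u r‖ ^ 2 := by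
    intro m
    have hnn : 0 ≤ ∫ r in (s - T)..s, (m * m + (-2 * m) * ‖u r‖ + ‖u r‖ ^ 2) :=
      intervalIntegral.integral_nonneg (by linarith) fun r _ => by
        nlinarith [sq_nonneg (‖u r‖ - m)]
    rw [intervalIntegral.integral_add (intervalIntegrable_const.add (hint1.const_mul _)) hint2,
      intervalIntegral.integral_add intervalIntegrable_const (hint1.const_mul _),
      intervalIntegral.integral_const_mul (-2 * m), intervalIntegral.integral_const,
      smul_eq_mul] at hnn
    linarith
  have := discrim_le_zero hquad
  rw [discrim] at this
  nlinarith

section ReversedDynamics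

variable {E : Type*} [NormedAddCommGroup E] [NormedSpace ℝ E]

/-- The integral equation forces its right-hand side to be integrable, hence `Y` to be
continuous: where the right-hand side fails to be integrable, `Y` would be constant. -/
theorem continuousOn_of_integral_equation {b : E → E} (hb : Continuous b) {Y u : ℝ → E}
    {t₀ M : ℝ} (hu : ∀ T, IntegrableOn u (Icc t₀ T)) (hM : ∀ t ∈ Ici t₀, ‖b (Y t)‖ ≤ M)
    (hY : ∀ s ∈ Ici t₀, Y s = Y t₀ + ∫ r in t₀..s, (-b (Y r) + u r)) :
    ContinuousOn Y (Ici t₀) := by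
  set f : ℝ → E := fun r => -b (Y r) + u r
  have hcont : ∀ s, IntegrableOn f (Icc t₀ s) → ContinuousOn Y (Icc t₀ s) := by
    intro s hs
    rcases le_or_gt t₀ s with hle | hlt
    · rw [← uIcc_of_le hle] at hs ⊢
      refine ((continuousOn_const (c := Y t₀)).add
        (intervalIntegral.continuousOn_primitive_interval hs)).congr fun x hx => ?_
      rw [uIcc_of_le hle] at hx
      exact hY x hx.1
    · simp [hlt]
  set G : Set ℝ := {s | t₀ ≤ s ∧ IntegrableOn f (Icc t₀ s)}
  have hGmeas : MeasurableSet G := by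
    refine OrdConnected.measurableSet ⟨fun x hx y hy z hz => ?_⟩
    exact ⟨hx.1.trans hz.1, hy.2.mono_set (Icc_subset_Icc_right hz.2)⟩
  have hGcont : ContinuousOn Y G := by
    intro x hx
    by_cases hmax : ∃ s ∈ G, x < s
    · obtain ⟨s, hs, hxs⟩ := hmax
      refine (hcont s hs.2 x ⟨hx.1, hxs.le⟩).mono_of_mem_nhdsWithin ?_
      filter_upwards [self_mem_nhdsWithin, mem_nhdsWithin_of_mem_nhds (Iio_mem_nhds hxs)]
        with z hz hzs using ⟨hz.1, le_of_lt hzs⟩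
    · push Not at hmax
      exact (hcont x hx.2 x ⟨hx.1, le_rfl⟩).mono fun z hz => ⟨hz.1, hmax z hz⟩
  have hint : ∀ T, IntegrableOn f (Icc t₀ T) := by
    intro T
    have hmeas : AEStronglyMeasurable (fun r => b (Y r)) (volume.restrict (Icc t₀ T)) := by
      rw [← inter_union_sdiff (Icc t₀ T) G, aestronglyMeasurable_union_iff]
      constructor
      · exact ((hb.comp_continuousOn hGcont).aestronglyMeasurable hGmeas).mono_set
          inter_subset_right
      · refine (aestronglyMeasurable_const (b := b (Y t₀))).congr ?_
        refine (ae_restrict_iff' (measurableSet_Icc.diff hGmeas)).2 (ae_of_all _ fun x hx => ?_)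
        have hnot : ¬ IntervalIntegrable f volume t₀ x := by
          rw [intervalIntegrable_iff_integrableOn_Icc_of_le hx.1.1]
          exact fun hx' => hx.2 ⟨hx.1.1, hx'⟩
        simp only [hY x hx.1.1, intervalIntegral.integral_undef hnot, add_zero]
    have hbY : IntegrableOn (fun r => b (Y r)) (Icc t₀ T) :=
      ⟨hmeas, .restrict_of_bounded (C := M) (by simp) <|
        (ae_restrict_iff' measurableSet_Icc).2 (ae_of_all _ fun x hx => hM x hx.1)⟩
    exact Integrable.add (Integrable.neg hbY) (hu T)
  intro x hx
  refine (hcont (x + 1) (hint _) x ⟨hx, by linarith⟩).mono_of_mem_nhdsWithin ?_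
  filter_upwards [self_mem_nhdsWithin, mem_nhdsWithin_of_mem_nhds (Iio_mem_nhds (lt_add_one x))]
    with z hz hzs using ⟨hz, le_of_lt hzs⟩

/-- Read backwards from time `s`, a trajectory of the reversed dynamics solves the forward
dynamics perturbed by the control. -/
theorem backward_integral_equation {b : E → E} (hb : Continuous b) {Y u : ℝ → E}
    (hYc : Continuous Y) {t₀ : ℝ} (hu : ∀ T, IntegrableOn u (Icc t₀ T))
    (hY : ∀ s ∈ Ici t₀, Y s = Y t₀ + ∫ r in t₀..s, (-b (Y r) + u r))
    {s t : ℝ} (ht : 0 ≤ t) (hst : t₀ ≤ s - t) :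
    Y (s - t) = Y s + (∫ r in (0:ℝ)..t, b (Y (s - r))) - ∫ r in (s - t)..s, u r := by
  have huI : ∀ a c, t₀ ≤ a → a ≤ c → IntervalIntegrable u volume a c := by
    intro a c ha hac
    rw [intervalIntegrable_iff_integrableOn_Icc_of_le hac]
    exact (hu c).mono_set (Icc_subset_Icc_left ha)
  have hbI : ∀ a c, IntervalIntegrable (fun r => -b (Y r)) volume a c := fun a c =>
    (hb.comp hYc).neg.intervalIntegrable a c
  have hsplit := intervalIntegral.integral_add_adjacent_intervals
    ((hbI t₀ (s - t)).add (huI t₀ (s - t) le_rfl hst))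
    ((hbI (s - t) s).add (huI (s - t) s hst (by linarith)))
  have hcomp := intervalIntegral.integral_comp_sub_left (a := 0) (b := t) (fun r => b (Y r)) s
  rw [sub_zero] at hcomp
  rw [hcomp, hY s (show t₀ ≤ s by linarith), hY (s - t) hst, ← hsplit,
    intervalIntegral.integral_add (hbI (s - t) s) (huI (s - t) s hst (by linarith)),
    intervalIntegral.integral_neg]
  abel

/-- Two backward pieces of the same trajectory stay close when their starting points are close
and the controls along them are small. -/
theorem norm_backward_sub_backward_le {b : E → E} {L : ℝ≥0} (hb : LipschitzWith L b)
    {Y u : ℝ → E} (hYc : Continuous Y) {t₀ : ℝ} (hu : ∀ T, IntegrableOn u (Icc t₀ T))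
    (hY : ∀ s ∈ Ici t₀, Y s = Y t₀ + ∫ r in t₀..s, (-b (Y r) + u r))
    {s s' T η : ℝ} (hT : 0 ≤ T) (hs : t₀ ≤ s - T) (hs' : t₀ ≤ s' - T)
    (hη : ‖Y s - Y s'‖ + (∫ r in (s - T)..s, ‖u r‖) + (∫ r in (s' - T)..s', ‖u r‖) = η) :
    ‖Y (s - T) - Y (s' - T)‖ ≤ η + L * gronwallBound 0 L η T := by
  have huI : ∀ a c, t₀ ≤ a → a ≤ c → IntervalIntegrable u volume a c := by
    intro a c ha hac
    rw [intervalIntegrable_iff_integrableOn_Icc_of_le hac]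
    exact (hu c).mono_set (Icc_subset_Icc_left ha)
  have hctrl : ∀ σ t, t₀ ≤ σ - T → t ∈ Icc 0 T →
      ‖∫ r in (σ - t)..σ, u r‖ ≤ ∫ r in (σ - T)..σ, ‖u r‖ := by
    intro σ t hσ ht
    refine (intervalIntegral.norm_integral_le_integral_norm (by linarith [ht.1])).trans ?_
    refine intervalIntegral.integral_mono_interval (by linarith [ht.2]) (by linarith [ht.1])
      le_rfl (ae_of_all _ fun r => norm_nonneg _) (huI _ _ hσ (by linarith)).norm
  have hYs : ∀ σ : ℝ, Continuous fun r => Y (σ - r) := fun σ => by fun_prop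
  refine le_add_mul_gronwallBound_of_le_integral (w := fun t => ‖Y (s - t) - Y (s' - t)‖)
    (by fun_prop) (fun t => norm_nonneg _) L.2 hT fun t ht => ?_
  have hbs : ∀ σ : ℝ, IntervalIntegrable (fun r => b (Y (σ - r))) volume 0 t := fun σ =>
    (hb.continuous.comp (hYs σ)).intervalIntegrable _ _
  have hdiff : ‖(∫ r in (0:ℝ)..t, b (Y (s - r))) - ∫ r in (0:ℝ)..t, b (Y (s' - r))‖
      ≤ L * ∫ r in (0:ℝ)..t, ‖Y (s - r) - Y (s' - r)‖ := by
    rw [← intervalIntegral.integral_sub (hbs s) (hbs s'), ← intervalIntegral.integral_const_mul]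
    refine intervalIntegral.norm_integral_le_of_norm_le ht.1
      (ae_of_all _ fun r _ => hb.norm_sub_le _ _) ?_
    exact Continuous.intervalIntegrable (by fun_prop) _ _
  have hdecomp : Y (s - t) - Y (s' - t) = (Y s - Y s')
      + ((∫ r in (0:ℝ)..t, b (Y (s - r))) - ∫ r in (0:ℝ)..t, b (Y (s' - r)))
      - (∫ r in (s - t)..s, u r) + ∫ r in (s' - t)..s', u r := by
    rw [backward_integral_equation hb.continuous hYc hu hY ht.1 (by linarith [ht.2] : t₀ ≤ s - t),
      backward_integral_equation hb.continuous hYc hu hY ht.1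
        (by linarith [ht.2] : t₀ ≤ s' - t)]
    abel
  have hnorm := norm_add_le ((Y s - Y s')
      + ((∫ r in (0:ℝ)..t, b (Y (s - r))) - ∫ r in (0:ℝ)..t, b (Y (s' - r)))
      - (∫ r in (s - t)..s, u r)) (∫ r in (s' - t)..s', u r)
  have hnorm' := norm_sub_le ((Y s - Y s')
      + ((∫ r in (0:ℝ)..t, b (Y (s - r))) - ∫ r in (0:ℝ)..t, b (Y (s' - r))))
      (∫ r in (s - t)..s, u r)
  have hnorm'' := norm_add_le (Y s - Y s')
      ((∫ r in (0:ℝ)..t, b (Y (s - r))) - ∫ r in (0:ℝ)..t, b (Y (s' - r)))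
  rw [← hdecomp] at hnorm
  linarith [hctrl s t hs ht, hctrl s' t hs' ht]

/-- If the control is square-integrable, backward pieces of a bounded trajectory started at
times `s n → ∞` with convergent `Y (s n)` converge to a solution of the forward equation. -/
theorem exists_forward_limit_of_backward [CompleteSpace E] {b : E → E} {L : ℝ≥0}
    (hb : LipschitzWith L b)
    {Y u : ℝ → E} (hYc : Continuous Y) (hum : StronglyMeasurable u) {t₀ M : ℝ}
    (hu2 : IntegrableOn (fun s => ‖u s‖ ^ 2) (Ici t₀)) (hM : ∀ t ∈ Ici t₀, ‖b (Y t)‖ ≤ M)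
    (hY : ∀ s ∈ Ici t₀, Y s = Y t₀ + ∫ r in t₀..s, (-b (Y r) + u r))
    {s : ℕ → ℝ} (hs : Tendsto s atTop atTop) (hYs : CauchySeq fun n => Y (s n)) :
    ∃ φ : ℝ → E, (∀ t ≥ 0, Tendsto (fun n => Y (s n - t)) atTop (𝓝 (φ t))) ∧
      ∀ t ≥ 0, φ t = φ 0 + ∫ r in (0:ℝ)..t, b (φ r) := by
  have hu : ∀ T, IntegrableOn u (Icc t₀ T) := fun T =>
    integrableOn_of_integrableOn_norm_sq hum.aestronglyMeasurable (by simp)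
      (hu2.mono_set Icc_subset_Ici_self)
  have hwin : ∀ t ≥ 0, Tendsto (fun n => ∫ r in (s n - t)..s n, ‖u r‖) atTop (𝓝 0) :=
    fun t ht => (tendsto_integral_norm_sliding_window hum hu2 ht).comp hs
  have hlarge : ∀ t : ℝ, ∀ᶠ n in atTop, t₀ ≤ s n - t := fun t => by
    filter_upwards [hs.eventually_ge_atTop (t₀ + t)] with n hn
    linarith
  have hcauchy : ∀ t ≥ 0, CauchySeq fun n => Y (s n - t) := by
    intro t ht
    have hη : Tendsto (fun q : ℕ × ℕ => ‖Y (s q.1) - Y (s q.2)‖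
        + (∫ r in (s q.1 - t)..s q.1, ‖u r‖) + ∫ r in (s q.2 - t)..s q.2, ‖u r‖)
        atTop (𝓝 0) := by
      have h0 : Tendsto (fun q : ℕ × ℕ => ‖Y (s q.1) - Y (s q.2)‖) atTop (𝓝 0) := by
        simpa only [dist_eq_norm] using cauchySeq_iff_tendsto_dist_atTop_0.1 hYs
      have hfst : Tendsto (Prod.fst : ℕ × ℕ → ℕ) atTop atTop := by
        rw [← prod_atTop_atTop_eq]; exact tendsto_fst
      have hsnd : Tendsto (Prod.snd : ℕ × ℕ → ℕ) atTop atTop := by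
        rw [← prod_atTop_atTop_eq]; exact tendsto_snd
      simpa using (h0.add ((hwin t ht).comp hfst)).add ((hwin t ht).comp hsnd)
    have hbd : Continuous fun η : ℝ => η + L * gronwallBound 0 L η t :=
      continuous_id.add (continuous_const.mul (gronwallBound_continuous_ε 0 L t))
    have hbd0 := (hbd.tendsto 0).comp hη
    rw [gronwallBound_ε0_δ0, mul_zero, add_zero] at hbd0
    rw [cauchySeq_iff_tendsto_dist_atTop_0]
    refine squeeze_zero' (Eventually.of_forall fun _ => dist_nonneg) ?_ hbd0
    have hev := (hlarge t).prod_mk (hlarge t)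
    rw [prod_atTop_atTop_eq] at hev
    filter_upwards [hev] with q hq
    rw [dist_eq_norm]
    exact norm_backward_sub_backward_le hb hYc hu hY ht hq.1 hq.2 rfl
  have hex : ∀ t : ℝ, ∃ x, 0 ≤ t → Tendsto (fun n => Y (s n - t)) atTop (𝓝 x) := fun t => by
    by_cases ht : 0 ≤ t
    · obtain ⟨x, hx⟩ := cauchySeq_tendsto_of_complete (hcauchy t ht)
      exact ⟨x, fun _ => hx⟩
    · exact ⟨0, fun h => absurd h ht⟩
  choose φ hφ using hex
  refine ⟨φ, fun t ht => hφ t ht, fun t ht => ?_⟩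
  have hdrift : Tendsto (fun n => ∫ r in (0:ℝ)..t, b (Y (s n - r))) atTop
      (𝓝 (∫ r in (0:ℝ)..t, b (φ r))) := by
    refine intervalIntegral.tendsto_integral_filter_of_dominated_convergence (fun _ => M)
      (Eventually.of_forall fun n => ?_) ?_ intervalIntegrable_const
      (ae_of_all _ fun r hr => ?_)
    · have : Continuous fun r => Y (s n - r) := by fun_prop
      exact (hb.continuous.comp this).aestronglyMeasurable
    · filter_upwards [hlarge t] with n hn
      refine ae_of_all _ fun r hr => hM _ ?_
      rw [uIoc_of_le ht] at hr
      exact hn.trans (by linarith [hr.2])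
    · rw [uIoc_of_le ht] at hr
      exact (hb.continuous.tendsto _).comp (hφ r hr.1.le)
  have hctrl : Tendsto (fun n => ∫ r in (s n - t)..s n, u r) atTop (𝓝 0) :=
    squeeze_zero_norm (fun n =>
      intervalIntegral.norm_integral_le_integral_norm (by linarith)) (hwin t ht)
  have hstart := hφ 0 le_rfl
  simp only [sub_zero] at hstart
  have hlim := (hstart.add hdrift).sub hctrl
  rw [sub_zero] at hlim
  refine tendsto_nhds_unique (hφ t ht) (hlim.congr' ?_)
  filter_upwards [hlarge t] with n hn
  exact (backward_integral_equation hb.continuous hYc hu hY ht hn).symm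

end ReversedDynamics

/-- if `Y` solves `Y' = -b(Y) + u` on `[t₀,∞)` with `u` Borel measurable and
locally square-integrable, and `Y` stays in a fixed annulus `r₁ < ‖Y(t)‖ < r₂`, then
`∫_{t₀}^∞ ‖u‖² = ∞`. -/
theorem control_cost_infinite_in_annulus
    (p : ℕ) (hp : 1 ≤ p) (b : Ep p → Ep p) (L : ℝ≥0)
    (hb : LipschitzWith L b) (hb0 : b 0 = 0)
    (hattract : ∀ φ : ℝ → Ep p, ForwardSol p b φ → Tendsto φ atTop (𝓝 0))
    (hstable : ∀ ε > (0:ℝ), ∃ δ > (0:ℝ), ∀ φ : ℝ → Ep p, ForwardSol p b φ →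
      ‖φ 0‖ ≤ δ → ∀ t ≥ (0:ℝ), ‖φ t‖ ≤ ε)
    (t₀ : ℝ) (ht₀ : 0 ≤ t₀) (Y u : ℝ → Ep p)
    (hu : Measurable u) (huloc : ∀ T : ℝ, IntegrableOn (fun s => ‖u s‖ ^ 2) (Icc t₀ T))
    (hY : ∀ s ∈ Ici t₀, Y s = Y t₀ + ∫ r in t₀..s, (-b (Y r) + u r))
    (r₁ r₂ : ℝ) (hr₁ : 0 < r₁) (hr₁₂ : r₁ < r₂)
    (hann : ∀ t ∈ Ici t₀, r₁ < ‖Y t‖ ∧ ‖Y t‖ < r₂) :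
    ∫⁻ s in Ici t₀, ENNReal.ofReal (‖u s‖ ^ 2) = ⊤ := by
  by_contra hfin
  have hu2 : IntegrableOn (fun s => ‖u s‖ ^ 2) (Ici t₀) := by
    refine ⟨(hu.norm.pow_const 2).aestronglyMeasurable, ?_⟩
    rw [hasFiniteIntegral_iff_ofReal (ae_of_all _ fun s => by positivity)]
    exact lt_top_iff_ne_top.2 hfin
  have hbnd : ∀ t ∈ Ici t₀, ‖b (Y t)‖ ≤ L * r₂ := fun t ht => by
    have := hb.norm_sub_le (Y t) 0
    rw [hb0, sub_zero, sub_zero] at this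
    exact this.trans (mul_le_mul_of_nonneg_left (hann t ht).2.le L.2)
  have hYc : ContinuousOn Y (Ici t₀) :=
    continuousOn_of_integral_equation hb.continuous (fun T =>
      integrableOn_of_integrableOn_norm_sq hu.aestronglyMeasurable (by simp) (huloc T)) hbnd hY
  obtain ⟨Z, hZc, hZY⟩ : ∃ Z : ℝ → Ep p, Continuous Z ∧ ∀ t ∈ Ici t₀, Z t = Y t :=
    ⟨fun t => Y (max t₀ t), hYc.comp_continuous (by fun_prop) fun t => mem_Ici.2 (le_max_left _ _),
      fun t ht => by simp only [max_eq_right (mem_Ici.1 ht)]⟩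
  have hZ : ∀ s ∈ Ici t₀, Z s = Z t₀ + ∫ r in t₀..s, (-b (Z r) + u r) := fun s hs => by
    rw [hZY s hs, hZY t₀ self_mem_Ici, hY s hs]
    congr 1
    refine intervalIntegral.integral_congr fun r hr => ?_
    rw [uIcc_of_le (mem_Ici.1 hs)] at hr
    simp only [hZY r hr.1]
  obtain ⟨x, -, k, hk, hx⟩ := (isCompact_closedBall (0 : Ep p) r₂).tendsto_subseq
    (x := fun n : ℕ => Z (t₀ + n)) fun n => by
      have hn : t₀ + (n : ℝ) ∈ Ici t₀ := by simp
      rw [hZY _ hn, mem_closedBall_zero_iff]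
      exact (hann _ hn).2.le
  have hs : Tendsto (fun n => t₀ + (k n : ℝ)) atTop atTop :=
    tendsto_atTop_add_const_left _ _ (tendsto_natCast_atTop_atTop.comp hk.tendsto_atTop)
  obtain ⟨φ, hφ, hsol⟩ := exists_forward_limit_of_backward hb hZc hu.stronglyMeasurable hu2
    (fun t ht => by rw [hZY t ht]; exact hbnd t ht) hZ hs hx.cauchySeq
  have hlow : ∀ t ≥ 0, r₁ ≤ ‖φ t‖ := fun t ht => by
    refine ge_of_tendsto (hφ t ht).norm ?_
    filter_upwards [hs.eventually_ge_atTop (t₀ + t)] with n hn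
    have hmem : t₀ + (k n : ℝ) - t ∈ Ici t₀ := by
      rw [mem_Ici]; linarith
    rw [hZY _ hmem]
    exact (hann _ hmem).1.le
  have hzero := (hattract φ hsol).norm
  rw [norm_zero] at hzero
  exact hr₁.not_ge (ge_of_tendsto hzero ((eventually_ge_atTop 0).mono hlow))

end
end

section
/- Let b : ℝ^p → ℝ^p be Lipschitz with constant L > 0, let T > 0, x ∈ ℝ^p, and let w : [0,T] → ℝ^p be bounded and Borel measurable. Then there exists a unique bounded Borel measurable y : [0,T] → ℝ^p satisfying y(t) = x + ∫₀^t b(y(s)) ds + w(t) for all t ∈ [0,T]. Moreover, if y₁, y₂ correspond to data (x₁, w₁) and (x₂, w₂) respectively, then sup_{0 ≤ t ≤ T} ‖y₁(t) − y₂(t)‖ ≤ e^{LT} ( ‖x₁ − x₂‖ + sup_{0 ≤ t ≤ T} ‖w₁(t) − w₂(t)‖ ). -/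
open MeasureTheory Set Filter Topology
open scoped ENNReal NNReal

noncomputable section

/-- `w` is bounded and Borel measurable on `[0,T]`. -/
def BddMeas (p : ℕ) (T : ℝ) (w : ℝ → Ep p) : Prop :=
  Measurable w ∧ ∃ M : ℝ, ∀ t ∈ Icc (0:ℝ) T, ‖w t‖ ≤ M

/-- `y` is a bounded Borel measurable solution on `[0,T]` of the perturbed integral
equation `y(t) = x + ∫₀ᵗ b(y(s)) ds + w(t)`. -/
def SolOf (p : ℕ) (b : Ep p → Ep p) (T : ℝ) (x : Ep p) (w y : ℝ → Ep p) : Prop :=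
  Measurable y ∧ (∃ M : ℝ, ∀ t ∈ Icc (0:ℝ) T, ‖y t‖ ≤ M) ∧
    ∀ t ∈ Icc (0:ℝ) T, y t = x + (∫ s in (0:ℝ)..t, b (y s)) + w t

section PerturbedIntegralEquation

/-- Integral form of Grönwall's inequality for continuous functions. -/
lemma le_mul_exp_of_le_add_integral {φ : ℝ → ℝ} {δ K T : ℝ} (hT : 0 ≤ T) (hK : 0 ≤ K)
    (hφ : ContinuousOn φ (Icc 0 T))
    (h : ∀ t ∈ Icc 0 T, φ t ≤ δ + K * ∫ s in (0:ℝ)..t, φ s) {t : ℝ} (ht : t ∈ Icc 0 T) :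
    φ t ≤ δ * Real.exp (K * t) := by
  set ψ : ℝ → ℝ := IccExtend hT ((Icc 0 T).domRestrict φ)
  have hψ : Continuous ψ := hφ.domRestrict.Icc_extend'
  have hψφ : ∀ s ∈ Icc 0 T, ψ s = φ s := fun s hs => by
    simp [ψ, IccExtend_of_mem hT _ hs]
  have hbound : ∀ s ∈ Icc 0 T, φ s ≤ δ + K * ∫ r in (0:ℝ)..s, ψ r := fun s hs => by
    have : ∫ r in (0:ℝ)..s, ψ r = ∫ r in (0:ℝ)..s, φ r :=
      intervalIntegral.integral_congr fun r hr => by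
        rw [uIcc_of_le hs.1] at hr
        exact hψφ r ⟨hr.1, hr.2.trans hs.2⟩
    rw [this]
    exact h s hs
  have hderiv : ∀ s, HasDerivAt (fun s => δ + K * ∫ r in (0:ℝ)..s, ψ r) (K * ψ s) s :=
    fun s => ((hψ.integral_hasStrictDerivAt 0 s).hasDerivAt.const_mul K).const_add δ
  refine (hbound t ht).trans ?_
  have := le_gronwallBound_of_liminf_deriv_right_le (δ := δ) (K := K) (ε := 0)
    (fun s _ => (hderiv s).continuousAt.continuousWithinAt)
    (fun s _ r hr => (hderiv s).hasDerivWithinAt.liminf_right_slope_le hr) (by simp)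
    (fun s hs => by
      rw [add_zero, hψφ s ⟨hs.1, hs.2.le⟩]
      exact mul_le_mul_of_nonneg_left (hbound s ⟨hs.1, hs.2.le⟩) hK) t ht
  simpa [gronwallBound_ε0] using this

variable {E : Type*} [NormedAddCommGroup E] [MeasurableSpace E] [BorelSpace E]
  [SecondCountableTopology E]

lemma LipschitzWith.intervalIntegrable_comp_of_bounded {b : E → E} {L : ℝ≥0}
    (hb : LipschitzWith L b) {T : ℝ} (hT : 0 ≤ T) {u : ℝ → E} (hu : Measurable u)
    (hbd : ∃ M : ℝ, ∀ t ∈ Icc 0 T, ‖u t‖ ≤ M) {t : ℝ} (ht : t ∈ Icc 0 T) :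
    IntervalIntegrable (fun s => b (u s)) volume 0 t := by
  obtain ⟨M, hM⟩ := hbd
  suffices h : IntervalIntegrable (fun s => b (u s)) volume 0 T by
    refine h.mono_set ?_
    rw [uIcc_of_le ht.1, uIcc_of_le hT]
    exact Icc_subset_Icc_right ht.2
  rw [intervalIntegrable_iff_integrableOn_Ioc_of_le hT]
  refine Measure.integrableOn_of_bounded (M := ‖b 0‖ + L * M) (by simp)
    (hb.continuous.measurable.comp hu).aestronglyMeasurable ?_
  refine (ae_restrict_iff' measurableSet_Ioc).2 (Eventually.of_forall fun s hs => ?_)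
  have h1 : ‖b (u s) - b 0‖ ≤ L * ‖u s‖ := by simpa using hb.norm_sub_le (u s) 0
  have h2 : (L : ℝ) * ‖u s‖ ≤ L * M := by gcongr; exact hM s ⟨hs.1.le, hs.2⟩
  have h3 := norm_sub_norm_le (b (u s)) (b 0)
  linarith

lemma exists_bounded_add_measurable {T : ℝ} (hT : 0 ≤ T) (z : C(Icc (0:ℝ) T, E)) {w : ℝ → E}
    (hw : Measurable w) (hbd : ∃ M : ℝ, ∀ t ∈ Icc 0 T, ‖w t‖ ≤ M) :
    Measurable (fun s => IccExtend hT z s + w s) ∧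
      ∃ M : ℝ, ∀ t ∈ Icc 0 T, ‖IccExtend hT z t + w t‖ ≤ M := by
  obtain ⟨M, hM⟩ := hbd
  refine ⟨z.continuous.Icc_extend'.measurable.add hw, ‖z‖ + M, fun t ht => ?_⟩
  exact (norm_add_le _ _).trans (add_le_add (z.norm_coe_le_norm _) (hM t ht))

variable [NormedSpace ℝ E]

lemma norm_sub_le_of_perturbed_integral_eq {b : E → E} {L : ℝ≥0} (hb : LipschitzWith L b)
    {T : ℝ} (hT : 0 ≤ T) {x₁ x₂ : E} {w₁ w₂ y₁ y₂ : ℝ → E}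
    (hm₁ : Measurable y₁) (hm₂ : Measurable y₂)
    (hbd₁ : ∃ M : ℝ, ∀ t ∈ Icc 0 T, ‖y₁ t‖ ≤ M) (hbd₂ : ∃ M : ℝ, ∀ t ∈ Icc 0 T, ‖y₂ t‖ ≤ M)
    (he₁ : ∀ t ∈ Icc 0 T, y₁ t = x₁ + (∫ s in (0:ℝ)..t, b (y₁ s)) + w₁ t)
    (he₂ : ∀ t ∈ Icc 0 T, y₂ t = x₂ + (∫ s in (0:ℝ)..t, b (y₂ s)) + w₂ t)
    {C : ℝ} (hC : ∀ t ∈ Icc 0 T, ‖w₁ t - w₂ t‖ ≤ C) {t : ℝ} (ht : t ∈ Icc 0 T) :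
    ‖y₁ t - y₂ t‖ ≤ Real.exp (L * T) * (‖x₁ - x₂‖ + C) := by
  have hi₁ := fun s (hs : s ∈ Icc 0 T) =>
    hb.intervalIntegrable_comp_of_bounded hT hm₁ hbd₁ hs
  have hi₂ := fun s (hs : s ∈ Icc 0 T) =>
    hb.intervalIntegrable_comp_of_bounded hT hm₂ hbd₂ hs
  set Z : ℝ → E := fun t => x₁ - x₂ + ∫ s in (0:ℝ)..t, (b (y₁ s) - b (y₂ s))
  have hdiff : ∀ s ∈ Icc 0 T, ‖y₁ s - y₂ s‖ ≤ ‖Z s‖ + C := fun s hs => by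
    have : y₁ s - y₂ s = Z s + (w₁ s - w₂ s) := by
      simp only [Z, intervalIntegral.integral_sub (hi₁ s hs) (hi₂ s hs)]
      rw [he₁ s hs, he₂ s hs]
      abel
    rw [this]
    exact (norm_add_le _ _).trans (by gcongr; exact hC s hs)
  have hTm : T ∈ Icc 0 T := ⟨hT, le_rfl⟩
  have hZ : ContinuousOn (fun s => ‖Z s‖ + C) (Icc 0 T) := by
    have := intervalIntegral.continuousOn_primitive_interval'
      ((hi₁ T hTm).sub (hi₂ T hTm)) left_mem_uIcc
    rw [uIcc_of_le hT] at this
    exact (this.const_add (x₁ - x₂)).norm.add_const C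
  have key : ‖Z t‖ + C ≤ (‖x₁ - x₂‖ + C) * Real.exp (L * t) := by
    refine le_mul_exp_of_le_add_integral hT L.coe_nonneg hZ (fun s hs => ?_) ht
    have hsub : uIcc 0 s ⊆ Icc 0 T := by
      rw [uIcc_of_le hs.1]
      exact Icc_subset_Icc_right hs.2
    have h1 : ‖∫ r in (0:ℝ)..s, (b (y₁ r) - b (y₂ r))‖ ≤
        ∫ r in (0:ℝ)..s, L * (‖Z r‖ + C) := by
      refine intervalIntegral.norm_integral_le_of_norm_le hs.1
        (Eventually.of_forall fun r hr => ?_) ((hZ.mono hsub).intervalIntegrable.const_mul _)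
      refine (hb.norm_sub_le _ _).trans ?_
      gcongr
      exact hdiff r ⟨hr.1.le, hr.2.trans hs.2⟩
    rw [intervalIntegral.integral_const_mul] at h1
    have h2 : ‖Z s‖ ≤ ‖x₁ - x₂‖ + ‖∫ r in (0:ℝ)..s, (b (y₁ r) - b (y₂ r))‖ :=
      norm_add_le _ _
    linarith
  have hC0 : 0 ≤ C := (norm_nonneg _).trans (hC t ht)
  calc ‖y₁ t - y₂ t‖ ≤ (‖x₁ - x₂‖ + C) * Real.exp (L * t) := (hdiff t ht).trans key
    _ ≤ (‖x₁ - x₂‖ + C) * Real.exp (L * T) := by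
      gcongr
      exact ht.2
    _ = _ := mul_comm _ _

lemma exists_perturbed_integral_eq [CompleteSpace E] {b : E → E} {L : ℝ≥0}
    (hb : LipschitzWith L b) {T : ℝ} (hT : 0 ≤ T) (x : E) {w : ℝ → E} (hw : Measurable w)
    (hbd : ∃ M : ℝ, ∀ t ∈ Icc 0 T, ‖w t‖ ≤ M) :
    ∃ y : ℝ → E, Measurable y ∧ (∃ M : ℝ, ∀ t ∈ Icc 0 T, ‖y t‖ ≤ M) ∧
      ∀ t ∈ Icc 0 T, y t = x + (∫ s in (0:ℝ)..t, b (y s)) + w t := by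
  have hintegrable := fun (z : C(Icc (0:ℝ) T, E)) t (ht : t ∈ Icc 0 T) =>
    hb.intervalIntegrable_comp_of_bounded hT
      (exists_bounded_add_measurable hT z hw hbd).1
      (exists_bounded_add_measurable hT z hw hbd).2 ht
  have hcont : ∀ z : C(Icc (0:ℝ) T, E), Continuous fun t : Icc (0:ℝ) T =>
      x + ∫ s in (0:ℝ)..t, b (IccExtend hT z s + w s) := fun z => by
    have := intervalIntegral.continuousOn_primitive_interval'
      (hintegrable z T ⟨hT, le_rfl⟩) left_mem_uIcc
    rw [uIcc_of_le hT] at this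
    exact (this.const_add x).domRestrict
  -- The Picard map in the variable `z = y - w`, some iterate of which is a contraction.
  let Φ : C(Icc (0:ℝ) T, E) → C(Icc (0:ℝ) T, E) := fun z => ⟨_, hcont z⟩
  have hiter : ∀ (n : ℕ) (z₁ z₂ : C(Icc (0:ℝ) T, E)) (t : Icc (0:ℝ) T),
      ‖Φ^[n] z₁ t - Φ^[n] z₂ t‖ ≤ (L * t) ^ n / n.factorial * dist z₁ z₂ := by
    intro n z₁ z₂
    induction n with
    | zero =>
      intro t
      simpa [← dist_eq_norm] using ContinuousMap.dist_apply_le_dist (f := z₁) (g := z₂) t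
    | succ n ih =>
      intro t
      rw [Function.iterate_succ_apply', Function.iterate_succ_apply']
      set u₁ := Φ^[n] z₁
      set u₂ := Φ^[n] z₂
      have hsub : Φ u₁ t - Φ u₂ t = ∫ s in (0:ℝ)..t,
          (b (IccExtend hT u₁ s + w s) - b (IccExtend hT u₂ s + w s)) := by
        rw [intervalIntegral.integral_sub (hintegrable u₁ t t.2) (hintegrable u₂ t t.2)]
        simp [Φ]
      rw [hsub]
      refine (intervalIntegral.norm_integral_le_of_norm_le t.2.1
        (g := fun s => L * ((L * s) ^ n / n.factorial * dist z₁ z₂))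
        (Eventually.of_forall fun s hs => ?_)
        (Continuous.intervalIntegrable (by fun_prop) _ _)).trans_eq ?_
      · have hsT : s ∈ Icc 0 T := ⟨hs.1.le, hs.2.trans t.2.2⟩
        refine (hb.norm_sub_le _ _).trans ?_
        rw [add_sub_add_right_eq_sub, IccExtend_of_mem hT _ hsT, IccExtend_of_mem hT _ hsT]
        gcongr
        exact ih ⟨s, hsT⟩
      · have : ∀ s : ℝ, L * ((L * s) ^ n / n.factorial * dist z₁ z₂) =
            (L ^ (n + 1) / n.factorial * dist z₁ z₂) * s ^ n := fun s => by ring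
        simp only [this, intervalIntegral.integral_const_mul, integral_pow]
        rw [Nat.factorial_succ]
        push_cast
        field_simp
        simp only [ne_eq, Nat.add_eq_zero_iff, one_ne_zero, and_false, not_false_eq_true, zero_pow,
          sub_zero]
        ring
  obtain ⟨n, hn⟩ : ∃ n : ℕ, (L * T) ^ n / n.factorial < 1 :=
    ((FloorSemiring.tendsto_pow_div_factorial_atTop (L * T)).eventually_lt_const
      one_pos).exists
  have hc0 : 0 ≤ (L * T) ^ n / n.factorial := by positivity
  have hcontr : ContractingWith (NNReal.mk ((L * T) ^ n / n.factorial) hc0) Φ^[n] := by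
    refine ⟨by exact_mod_cast hn, LipschitzWith.of_dist_le_mul fun z₁ z₂ => ?_⟩
    rw [NNReal.coe_mk, ContinuousMap.dist_le (mul_nonneg hc0 dist_nonneg)]
    intro t
    rw [dist_eq_norm]
    refine (hiter n z₁ z₂ t).trans ?_
    have ht0 := t.2.1
    have htT := t.2.2
    gcongr
  obtain ⟨z, hz⟩ : ∃ z, Φ z = z := ⟨_, hcontr.isFixedPt_fixedPoint_iterate⟩
  obtain ⟨hm, hM⟩ := exists_bounded_add_measurable hT z hw hbd
  refine ⟨fun s => IccExtend hT z s + w s, hm, hM, fun t ht => ?_⟩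
  have : z ⟨t, ht⟩ = x + ∫ s in (0:ℝ)..t, b (IccExtend hT z s + w s) :=
    (DFunLike.congr_fun hz ⟨t, ht⟩).symm
  simp only [IccExtend_of_mem hT _ ht, this]

end PerturbedIntegralEquation

/-- well-posedness of the perturbed integral equation and sup-norm
Lipschitz dependence of the solution on the data `(x, w)`:
`sup_{t≤T} ‖y₁(t) - y₂(t)‖ ≤ e^{LT}(‖x₁ - x₂‖ + sup_{t≤T} ‖w₁(t) - w₂(t)‖)`. -/
theorem solution_map_wellposed_and_lipschitz
    (p : ℕ) (hp : 1 ≤ p) (b : Ep p → Ep p) (L : ℝ≥0) (hL : 0 < L)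
    (hb : LipschitzWith L b) (T : ℝ) (hT : 0 < T) :
    (∀ (x : Ep p) (w : ℝ → Ep p), BddMeas p T w →
      ∃ y : ℝ → Ep p, SolOf p b T x w y ∧
        ∀ y' : ℝ → Ep p, SolOf p b T x w y' → ∀ t ∈ Icc (0:ℝ) T, y' t = y t) ∧
    (∀ (x₁ x₂ : Ep p) (w₁ w₂ y₁ y₂ : ℝ → Ep p),
      BddMeas p T w₁ → BddMeas p T w₂ →
      SolOf p b T x₁ w₁ y₁ → SolOf p b T x₂ w₂ y₂ →
      ∀ C : ℝ, (∀ t ∈ Icc (0:ℝ) T, ‖w₁ t - w₂ t‖ ≤ C) →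
      ∀ t ∈ Icc (0:ℝ) T,
        ‖y₁ t - y₂ t‖ ≤ Real.exp ((L : ℝ) * T) * (‖x₁ - x₂‖ + C)) := by
  refine ⟨fun x w hw => ?_, fun x₁ x₂ w₁ w₂ y₁ y₂ _ _ h₁ h₂ C hC t ht => ?_⟩
  · obtain ⟨y, hy⟩ := exists_perturbed_integral_eq hb hT.le x hw.1 hw.2
    refine ⟨y, hy, fun y' hy' t ht => ?_⟩
    have := norm_sub_le_of_perturbed_integral_eq hb hT.le hy'.1 hy.1 hy'.2.1 hy.2.1
      hy'.2.2 hy.2.2 (C := 0) (by simp) ht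
    simpa [sub_eq_zero] using this
  · exact norm_sub_le_of_perturbed_integral_eq hb hT.le h₁.1 h₂.1 h₁.2.1 h₂.2.1
      h₁.2.2 h₂.2.2 hC ht

end
end
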